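/- Let k ⊆ E ⊆ L ⊆ k̄ be fields with L/E a finite Galois extension with [L : E] = p^s · n where p ∤ n and n > 1. Then L/E is not a cyclotomic coradical extension. -/

import Mathlib

open Polynomial IntermediateField

noncomputable section

variable (Fq : Type) [Field Fq] [Fintype Fq]

/-- A fixed algebraic closure of the rational function field `k = Fq(T)`. -/
abbrev Kbar := AlgebraicClosure (RatFunc Fq)

/-- The Carlitz action of `T`: the `Fq`-linear map `u ↦ T•u + u^q`. -/
def carlitzT : Module.End Fq (Kbar Fq) where
  toFun u := algebraMap (RatFunc Fq) (Kbar Fq) RatFunc.X * u + u ^ Fintype.card Fq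
  map_add' u v := by
    obtain ⟨n, hp, hcard⟩ := FiniteField.card Fq (ringChar Fq)
    haveI : Fact (ringChar Fq).Prime := ⟨hp⟩
    haveI : CharP (Kbar Fq) (ringChar Fq) :=
      charP_of_injective_algebraMap (algebraMap Fq (Kbar Fq)).injective _
    show algebraMap (RatFunc Fq) (Kbar Fq) RatFunc.X * (u + v) + (u + v) ^ Fintype.card Fq =
      (algebraMap (RatFunc Fq) (Kbar Fq) RatFunc.X * u + u ^ Fintype.card Fq) +
        (algebraMap (RatFunc Fq) (Kbar Fq) RatFunc.X * v + v ^ Fintype.card Fq)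
    rw [hcard, add_pow_char_pow]
    ring
  map_smul' c u := by
    simp only [RingHom.id_apply, smul_add, mul_smul_comm, _root_.smul_pow, FiniteField.pow_card]

/-- The Carlitz module: the `Fq`-algebra morphism `Fq[T] → End_{Fq}(k̄)`
determined by `T ↦ (u ↦ T·u + u^q)`. -/
def carlitzHom : Polynomial Fq →ₐ[Fq] Module.End Fq (Kbar Fq) :=
  aeval (carlitzT Fq)

/-- The Carlitz action `C_a(u)`. -/
def carlitz (a : Polynomial Fq) (u : Kbar Fq) : Kbar Fq :=
  carlitzHom Fq a u

/-- `Λ_a = {u ∈ k̄ : C_a(u) = 0}`. -/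
def Lambda (a : Polynomial Fq) : Set (Kbar Fq) := {u | carlitz Fq a u = 0}

/-- The Carlitz torsion `μ(L)` of an intermediate field `L`. -/
def carlitzTorsion (L : IntermediateField (RatFunc Fq) (Kbar Fq)) : Set (Kbar Fq) :=
  {u | u ∈ L ∧ ∃ a : Polynomial Fq, a ≠ 0 ∧ carlitz Fq a u = 0}

/-- `DrinT(L/K) = {u ∈ L : C_m(u) ∈ K for some nonzero m}`. -/
def DrinT (K L : IntermediateField (RatFunc Fq) (Kbar Fq)) : Set (Kbar Fq) :=
  {u | u ∈ L ∧ ∃ m : Polynomial Fq, m ≠ 0 ∧ carlitz Fq m u ∈ K}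

/-- `L/K` is radical: `L = K(X)` for some `X ⊆ DrinT(L/K)`. -/
def IsRadicalC (K L : IntermediateField (RatFunc Fq) (Kbar Fq)) : Prop :=
  ∃ X ⊆ DrinT Fq K L, L = adjoin (RatFunc Fq) ((K : Set (Kbar Fq)) ∪ X)

/-- `L/K` is pure: every root in `L` of some `C_m`, `m` irreducible, lies in `K`. -/
def IsPureC (K L : IntermediateField (RatFunc Fq) (Kbar Fq)) : Prop :=
  ∀ m : Polynomial Fq, Irreducible m → ∀ u ∈ L, carlitz Fq m u = 0 → u ∈ K

/-- `L/K` is separable: every element of `L` is separable over `K`. -/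
def IsSeparableC (K L : IntermediateField (RatFunc Fq) (Kbar Fq)) : Prop :=
  ∀ u ∈ L, IsSeparable K u

/-- `L/K` is cyclotomic coradical: radical, separable and pure. -/
def IsCycloCoradicalC (K L : IntermediateField (RatFunc Fq) (Kbar Fq)) : Prop :=
  IsRadicalC Fq K L ∧ IsSeparableC Fq K L ∧ IsPureC Fq K L


variable {Fq}

lemma carlitz_C (c : Fq) (u : Kbar Fq) : carlitz Fq (C c) u = c • u := by
  simp [carlitz, carlitzHom]

lemma carlitz_X (u : Kbar Fq) : carlitz Fq X u =
    algebraMap (RatFunc Fq) (Kbar Fq) RatFunc.X * u + u ^ Fintype.card Fq := by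
  simp [carlitz, carlitzHom, carlitzT]

lemma carlitz_add (a b : Polynomial Fq) (u : Kbar Fq) :
    carlitz Fq (a + b) u = carlitz Fq a u + carlitz Fq b u := by
  simp [carlitz]

lemma carlitz_mul (a b : Polynomial Fq) (u : Kbar Fq) :
    carlitz Fq (a * b) u = carlitz Fq a (carlitz Fq b u) := by
  simp [carlitz]

lemma carlitz_sub_right (a : Polynomial Fq) (u v : Kbar Fq) :
    carlitz Fq a (u - v) = carlitz Fq a u - carlitz Fq a v :=
  map_sub (carlitzHom Fq a) u v

lemma carlitz_mem (L : IntermediateField (RatFunc Fq) (Kbar Fq)) (a : Polynomial Fq)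
    {u : Kbar Fq} (hu : u ∈ L) : carlitz Fq a u ∈ L := by
  induction a using Polynomial.induction_on' generalizing u with
  | add a b ha hb => rw [carlitz_add]; exact add_mem (ha hu) (hb hu)
  | monomial n c =>
    rw [← C_mul_X_pow_eq_monomial, carlitz_mul, carlitz_C, ← algebraMap_smul (RatFunc Fq) c]
    refine L.smul_mem ?_
    induction n generalizing u with
    | zero => simpa [carlitz] using hu
    | succ n ih =>
      rw [pow_succ, carlitz_mul]
      refine ih ?_
      rw [carlitz_X]
      exact add_mem (mul_mem (L.algebraMap_mem _) hu) (pow_mem hu _)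

lemma carlitz_map (τ : Kbar Fq →ₐ[RatFunc Fq] Kbar Fq) (a : Polynomial Fq) (u : Kbar Fq) :
    τ (carlitz Fq a u) = carlitz Fq a (τ u) := by
  induction a using Polynomial.induction_on' generalizing u with
  | add a b ha hb => rw [carlitz_add, map_add, ha, hb, carlitz_add]
  | monomial n c =>
    rw [← C_mul_X_pow_eq_monomial, carlitz_mul, carlitz_C, carlitz_mul, carlitz_C,
      ← algebraMap_smul (RatFunc Fq) c, ← algebraMap_smul (RatFunc Fq) c, map_smul]
    congr 1
    induction n generalizing u with
    | zero => simp [carlitz]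
    | succ n ih => simp [pow_succ, carlitz_mul, ih, carlitz_X]

/-- In a pure extension `L/E`, an automorphism over `E` whose `ℓ`-th power is trivial on `L`, with
`ℓ` nonzero in `k̄`, fixes every `u ∈ L` for which it fixes some `C_m(u)`, `m ≠ 0`. -/
lemma IsPureC.map_eq_self {E L : IntermediateField (RatFunc Fq) (Kbar Fq)} (hpure : IsPureC Fq E L)
    (τ : Kbar Fq →ₐ[RatFunc Fq] Kbar Fq) (hE : ∀ x ∈ E, τ x = x) (hL : ∀ x ∈ L, τ x ∈ L)
    {l : ℕ} (hl : (l : Kbar Fq) ≠ 0) (hτ : ∀ x ∈ L, τ^[l] x = x)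
    {m : Polynomial Fq} (hm : m ≠ 0) {u : Kbar Fq} (hu : u ∈ L)
    (hmu : τ (carlitz Fq m u) = carlitz Fq m u) : τ u = u := by
  induction m using WfDvdMonoid.induction_on_irreducible generalizing u with
  | zero => exact absurd rfl hm
  | unit m hunit =>
    obtain ⟨c, hc, rfl⟩ := Polynomial.isUnit_iff.mp hunit
    rw [carlitz_map, ← sub_eq_zero, ← carlitz_sub_right, carlitz_C] at hmu
    exact sub_eq_zero.mp ((smul_eq_zero.mp hmu).resolve_left hc.ne_zero)
  | mul b π hb hπ ih =>
    rw [mul_comm, carlitz_mul] at hmu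
    have hfix := ih hb (carlitz_mem L π hu) hmu
    rw [carlitz_map, ← sub_eq_zero, ← carlitz_sub_right] at hfix
    have hc := hE _ (hpure π hπ _ (sub_mem (hL u hu) hu) hfix)
    have hiter (k : ℕ) : τ^[k] u = u + k * (τ u - u) := by
      induction k with
      | zero => simp
      | succ k ihk =>
        rw [Function.iterate_succ_apply', ihk, map_add, map_mul, hc, map_natCast]
        push_cast
        ring
    have hzero := hiter l
    rw [hτ u hu, left_eq_add] at hzero
    exact sub_eq_zero.mp ((mul_eq_zero.mp hzero).resolve_left hl)

variable (Fq)

/-- If `L/E` is a finite Galois extension with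
`[L : E] = p^s * n`, `p ∤ n` and `n > 1`, then `L/E` is not cyclotomic coradical. -/
theorem not_isCycloCoradical_of_degree_ne_p_pow (p : ℕ) [Fact p.Prime] [CharP Fq p]
    (E L : IntermediateField (RatFunc Fq) (Kbar Fq)) (hEL : E ≤ L)
    (hfin : FiniteDimensional E (extendScalars hEL))
    (hgal : IsGalois E (extendScalars hEL))
    (s n : ℕ) (hpn : ¬ p ∣ n) (hn : 1 < n)
    (hdeg : Module.finrank E (extendScalars hEL) = p ^ s * n) :
    ¬ IsCycloCoradicalC Fq E L := by
  rintro ⟨⟨X, hX, hLX⟩, -, hpure⟩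
  obtain ⟨l, hlprime, hln⟩ := Nat.exists_prime_and_dvd hn.ne'
  have : Fact l.Prime := ⟨hlprime⟩
  have : CharP (Kbar Fq) p :=
    charP_of_injective_algebraMap (algebraMap Fq (Kbar Fq)).injective p
  have hl : (l : Kbar Fq) ≠ 0 := by
    rw [Ne, CharP.cast_eq_zero_iff (Kbar Fq) p]
    exact fun h => hpn (h.trans hln)
  obtain ⟨σ, hσ⟩ := exists_prime_orderOf_dvd_card' (G := Gal(extendScalars hEL/E)) l (by
    rw [IsGalois.card_aut_eq_finrank, hdeg]
    exact hln.mul_left _)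
  have : Normal E (Kbar Fq) := normal_iff.mpr fun x =>
    ⟨(Algebra.IsAlgebraic.isAlgebraic (R := RatFunc Fq) x).tower_top E |>.isIntegral,
      IsAlgClosed.splits _⟩
  let τ : Kbar Fq →ₐ[RatFunc Fq] Kbar Fq :=
    (σ.liftNormal (Kbar Fq)).toAlgHom.restrictScalars (RatFunc Fq)
  have hτσ (x : extendScalars hEL) : τ x = σ x := σ.liftNormal_commutes (Kbar Fq) x
  have hE : ∀ x ∈ E, τ x = x := fun x hx => (σ.liftNormal (Kbar Fq)).commutes ⟨x, hx⟩
  have hL : ∀ x ∈ L, τ x ∈ L := fun x hx => by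
    rw [hτσ ⟨x, hx⟩]
    exact (σ ⟨x, hx⟩).2
  have hiter (k : ℕ) (x : extendScalars hEL) : τ^[k] x = (σ ^ k) x := by
    induction k with
    | zero => simp
    | succ k ih => rw [Function.iterate_succ_apply', ih, hτσ, pow_succ', AlgEquiv.mul_apply]
  have hτ : ∀ x ∈ L, τ^[l] x = x := fun x hx => by
    rw [hiter l ⟨x, hx⟩, ← hσ, pow_orderOf_eq_one, AlgEquiv.one_apply]
  have hLfix : ∀ x ∈ L, τ x = x := fun x hx => by
    rw [hLX] at hx
    induction hx using adjoin_induction with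
    | mem x hx =>
      rcases hx with hx | hx
      · exact hE x hx
      · obtain ⟨hxL, m, hm, hmx⟩ := hX hx
        exact hpure.map_eq_self τ hE hL hl hτ hm hxL (hE _ hmx)
    | algebraMap x => exact τ.commutes x
    | add x y _ _ hx hy => rw [map_add, hx, hy]
    | inv x _ hx => rw [map_inv₀, hx]
    | mul x y _ _ hx hy => rw [map_mul, hx, hy]
  refine hlprime.ne_one (hσ ▸ orderOf_eq_one_iff.mpr (AlgEquiv.ext fun x => Subtype.ext ?_))
  rw [← hτσ]
  exact hLfix x x.2

end
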